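/- The sequence of primes is pseudo equidistributed mod 1: for all 0 ≤ a < b ≤ 1, the proportion of indices r ≤ n with a ≤ p_r/p_n ≤ b tends to b - a as n → ∞. -/

import Mathlib

open Filter Real
open scoped Classical

/-- `p n` is the n-th prime, 1-indexed: `p 1 = 2`. -/
noncomputable def p (n : ℕ) : ℕ := Nat.nth Nat.Prime (n - 1)

/-- Normalised Chebyshev function in logarithmic scale. -/
noncomputable def BB (u : ℝ) : ℝ := Chebyshev.psi (Real.exp u) * Real.exp (-u)

lemma BB_nonneg (u : ℝ) : 0 ≤ BB u :=
  mul_nonneg (Chebyshev.psi_nonneg _) (Real.exp_pos _).le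

lemma BB_le (u : ℝ) : BB u ≤ Real.log 4 + 4 := by
  unfold BB
  have h := Chebyshev.psi_le_const_mul_self (Real.exp_pos u).le
  calc Chebyshev.psi (Real.exp u) * Real.exp (-u)
      ≤ ((Real.log 4 + 4) * Real.exp u) * Real.exp (-u) := by gcongr
    _ = Real.log 4 + 4 := by rw [mul_assoc, ← Real.exp_add]; simp

lemma BB_mono {u v : ℝ} (h : u ≤ v) : BB u * Real.exp (u - v) ≤ BB v := by
  unfold BB
  rw [mul_assoc, ← Real.exp_add, show -u + (u - v) = -v by ring]
  exact mul_le_mul_of_nonneg_right (Chebyshev.psi_mono (Real.exp_le_exp.2 h)) (Real.exp_pos _).le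

lemma BB_zero {u : ℝ} (h : u ≤ 0) : BB u = 0 := by
  unfold BB
  rw [Chebyshev.psi_eq_zero_of_le_one (Real.exp_le_one_iff.2 h), zero_mul]

lemma BB_meas : Measurable BB := by
  unfold BB
  exact (Chebyshev.psi_mono.measurable.comp Real.measurable_exp).mul
    (Real.measurable_exp.comp measurable_neg)

/-- Continuous extension of the Laplace transform. -/
noncomputable def GG (s : ℂ) : ℂ :=
  (ArithmeticFunction.vonMangoldt.LFunctionResidueClassAux (1 : ZMod 1) s - 1) / s

lemma GG_cont : ContinuousOn GG {s | 1 ≤ s.re} := by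
  unfold GG
  refine ((ArithmeticFunction.vonMangoldt.continuousOn_LFunctionResidueClassAux
    (1 : ZMod 1)).sub continuousOn_const).div continuousOn_id ?_
  rintro s hs rfl
  simp at hs
  linarith

lemma resid_eq (n : ℕ) : ArithmeticFunction.vonMangoldt.residueClass (1 : ZMod 1) n =
    ArithmeticFunction.vonMangoldt n := by
  unfold ArithmeticFunction.vonMangoldt.residueClass
  rw [Set.indicator_of_mem]
  exact Subsingleton.elim _ _

lemma sum_eq_psi (x : ℝ) : ∑ k ∈ Finset.Icc 1 ⌊x⌋₊,
    ArithmeticFunction.vonMangoldt k = Chebyshev.psi x := by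
  unfold Chebyshev.psi
  rfl

lemma GG_eq0 {s : ℂ} (hs : 1 < s.re) :
    GG s = (∫ u in Set.Ioi (0:ℝ), (BB u : ℂ) * Complex.exp (-(s-1) * u)) - 1 / (s - 1) := by
  have h1 := ArithmeticFunction.vonMangoldt.eqOn_LFunctionResidueClassAux
    (a := (1 : ZMod 1)) isUnit_one hs
  have hs0 : s ≠ 0 := by rintro rfl; simp at hs; linarith
  have hs1 : s - 1 ≠ 0 := by
    intro h
    have : s = 1 := by linear_combination h
    rw [this] at hs; simp at hs
  have h2 := LSeries_eq_mul_integral_of_nonneg (fun n => ArithmeticFunction.vonMangoldt n)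
    zero_le_one hs (by
      refine Asymptotics.IsBigO.of_bound (Real.log 4 + 4) (Eventually.of_forall fun n => ?_)
      have := Chebyshev.psi_le_const_mul_self (Nat.cast_nonneg (α := ℝ) n)
      have h3 := sum_eq_psi n
      rw [Nat.floor_natCast] at h3
      rw [h3, Real.rpow_one, Real.norm_of_nonneg (Chebyshev.psi_nonneg _)]
      simpa using this) (fun n => ArithmeticFunction.vonMangoldt_nonneg)
  have h4 : ∫ (t : ℝ) in Set.Ioi 1, (∑ k ∈ Finset.Icc 1 ⌊t⌋₊,
      ((ArithmeticFunction.vonMangoldt k : ℝ) : ℂ)) * (t : ℂ) ^ (-(s + 1))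
      = ∫ u in Set.Ioi (0:ℝ), (BB u : ℂ) * Complex.exp (-(s-1) * u) := by
    have him : Real.exp '' Set.Ioi 0 = Set.Ioi 1 := by
      ext y
      simp only [Set.mem_image, Set.mem_Ioi]
      constructor
      · rintro ⟨x, hx, rfl⟩; exact Real.one_lt_exp_iff.2 hx
      · intro hy; exact ⟨Real.log y, Real.log_pos hy, Real.exp_log (by linarith)⟩
    rw [← him, MeasureTheory.integral_image_eq_integral_abs_deriv_smul measurableSet_Ioi
      (fun x _ => (Real.hasDerivAt_exp x).hasDerivWithinAt) Real.exp_injective.injOn]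
    refine MeasureTheory.setIntegral_congr_fun measurableSet_Ioi fun u _ => ?_
    rw [← Complex.ofReal_sum, sum_eq_psi, abs_of_pos (Real.exp_pos _), Complex.real_smul]
    have he : ((Real.exp u : ℝ) : ℂ) ≠ 0 := by
      exact_mod_cast (Real.exp_pos u).ne'
    rw [Complex.cpow_def_of_ne_zero he, ← Complex.ofReal_log (Real.exp_pos u).le, Real.log_exp]
    unfold BB
    push_cast
    rw [mul_left_comm, mul_assoc, ← Complex.exp_add, ← Complex.exp_add]
    congr 2
    ring
  rw [h4] at h2
  unfold GG
  rw [h1]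
  simp only [resid_eq]
  rw [h2]
  simp
  field_simp
  ring

lemma GG_eq {s : ℂ} (hs : 1 < s.re) :
    GG s = ∫ u in Set.Ioi (0:ℝ), ((BB u - 1 : ℝ) : ℂ) * Complex.exp (-(s-1) * u) := by
  have hre : (-(s-1)).re < 0 := by simp; linarith
  have hi := integrableOn_exp_mul_complex_Ioi hre 0
  have hi2 : MeasureTheory.IntegrableOn
      (fun u : ℝ => (BB u : ℂ) * Complex.exp (-(s-1) * u)) (Set.Ioi 0) := by
    refine MeasureTheory.Integrable.bdd_mul (c := Real.log 4 + 4) hi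
      (Complex.measurable_ofReal.comp BB_meas).aestronglyMeasurable (Eventually.of_forall fun u => ?_)
    rw [Complex.norm_real, Real.norm_of_nonneg (BB_nonneg u)]
    exact BB_le u
  rw [GG_eq0 hs]
  have := integral_exp_mul_complex_Ioi hre 0
  simp only [Complex.ofReal_sub, Complex.ofReal_one, sub_mul, one_mul]
  rw [MeasureTheory.integral_sub hi2 hi]
  congr 1
  simp only [Complex.ofReal_zero, mul_zero, Complex.exp_zero, neg_div_neg_eq] at this
  rw [← this]

/-- Fejér kernel. -/
noncomputable def kk (T x : ℝ) : ℝ := 2 * (1 - Real.cos (T * x)) / (T * x ^ 2)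

lemma kk_nonneg {T : ℝ} (hT : 0 < T) (x : ℝ) : 0 ≤ kk T x := by
  unfold kk
  have := Real.cos_le_one (T * x)
  apply div_nonneg <;> [linarith; positivity]

lemma kk_meas (T : ℝ) : Measurable (kk T) := by
  unfold kk
  fun_prop

lemma kk_le {T : ℝ} (hT : 0 < T) (x : ℝ) : kk T x ≤ (T + 4 / T) * (1 + x ^ 2)⁻¹ := by
  unfold kk
  rcases eq_or_ne x 0 with rfl | hx
  · simp; positivity
  have hx2 : 0 < x ^ 2 := by positivity
  have h1 := Real.one_sub_sq_div_two_le_cos (x := T * x)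
  have h2 := Real.neg_one_le_cos (T * x)
  rw [← div_eq_mul_inv, div_le_div_iff₀ (by positivity) (by positivity)]
  have h3 : 2 * (1 - Real.cos (T * x)) ≤ T ^ 2 * x ^ 2 := by nlinarith
  have h4 : 2 * (1 - Real.cos (T * x)) ≤ 4 := by linarith
  have h5 : (T + 4 / T) * (T * x ^ 2) = T ^ 2 * x ^ 2 + 4 * x ^ 2 := by field_simp
  rw [h5]
  nlinarith

lemma kk_int {T : ℝ} (hT : 0 < T) : MeasureTheory.Integrable (kk T) := by
  refine (integrable_inv_one_add_sq.const_mul (T + 4 / T)).mono'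
    (kk_meas T).aestronglyMeasurable (Eventually.of_forall fun x => ?_)
  rw [Real.norm_of_nonneg (kk_nonneg hT x)]
  exact kk_le hT x

lemma kk_scale {T : ℝ} (hT : 0 < T) (z : ℝ) : kk T (T⁻¹ * z) = T * kk 1 z := by
  unfold kk
  rw [mul_inv_cancel_left₀ hT.ne', one_mul, one_mul]
  rcases eq_or_ne z 0 with rfl | hx
  · simp
  field_simp

lemma kk_integral_scale {T : ℝ} (hT : 0 < T) (g : ℝ → ℝ) :
    ∫ x, g x * kk T x = ∫ z, g (T⁻¹ * z) * kk 1 z := by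
  have := MeasureTheory.Measure.integral_comp_mul_left (fun x => g x * kk T x) T⁻¹
  simp only [inv_inv, abs_of_pos hT, smul_eq_mul, kk_scale hT] at this
  rw [← mul_right_inj' hT.ne', ← this, ← MeasureTheory.integral_const_mul]
  congr 1
  ext z
  ring

lemma kk_pos : 0 < ∫ x, kk 1 x := by
  rw [MeasureTheory.integral_pos_iff_support_of_nonneg (kk_nonneg one_pos) (kk_int one_pos)]
  refine lt_of_lt_of_le ?_ (MeasureTheory.measure_mono (s := Set.Ioo (0:ℝ) 1) ?_)
  · simp
  · intro x hx
    have h1 : Real.cos x < 1 := by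
      have := Real.cos_lt_cos_of_nonneg_of_le_pi le_rfl (by linarith [hx.2, Real.pi_gt_three]) hx.1
      simpa using this
    have hx0 := hx.1
    have : 0 < kk 1 x := by
      unfold kk
      rw [one_mul]
      apply div_pos
      · linarith
      · positivity
    exact this.ne'

/-- Triangle function. -/
noncomputable def tri (T t : ℝ) : ℝ := 1 - |t| / T

lemma tri_cont (T : ℝ) : Continuous (tri T) := by unfold tri; fun_prop

lemma half_int {S x : ℝ} (hS : S ≠ 0) (hx : x ≠ 0) (a b : ℝ) :
    ∫ t in a..b, ((1 - t / S : ℝ) : ℂ) * Complex.exp (Complex.I * x * t) =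
    ((1 - b / S) * Complex.exp (Complex.I * x * b) / (Complex.I * x)
        + Complex.exp (Complex.I * x * b) / (S * (Complex.I * x) ^ 2)) -
    ((1 - a / S) * Complex.exp (Complex.I * x * a) / (Complex.I * x)
        + Complex.exp (Complex.I * x * a) / (S * (Complex.I * x) ^ 2)) := by
  have hz : Complex.I * (x : ℂ) ≠ 0 := mul_ne_zero Complex.I_ne_zero (by exact_mod_cast hx)
  have hS' : (S : ℂ) ≠ 0 := by exact_mod_cast hS
  generalize Complex.I * (x : ℂ) = w at *
  have hd : ∀ t : ℝ, HasDerivAt (fun t : ℝ => (1 - (t:ℂ) / S) * Complex.exp (w * t) / w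
        + Complex.exp (w * t) / (S * w ^ 2)) (((1 - t / S : ℝ) : ℂ) * Complex.exp (w * t)) t := by
    intro t
    have h0 : HasDerivAt (fun t : ℂ => (1 - t / S) * Complex.exp (w * t) / w
        + Complex.exp (w * t) / (S * w ^ 2)) (((1 - t / S : ℝ) : ℂ) * Complex.exp (w * t)) (t : ℂ) := by
      have he : HasDerivAt (fun t : ℂ => Complex.exp (w * t)) (Complex.exp (w * t) * (w * 1)) (t : ℂ) :=
        ((hasDerivAt_id (t : ℂ)).const_mul w).cexp
      have h1 : HasDerivAt (fun t : ℂ => 1 - t / S) (-(1 / S)) (t : ℂ) := by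
        simpa using ((hasDerivAt_id (t : ℂ)).div_const (S : ℂ)).const_sub 1
      refine (((h1.mul he).div_const w).add (he.div_const (S * w ^ 2))).congr_deriv ?_
      push_cast
      field_simp
      ring
    exact h0.comp_ofReal
  rw [intervalIntegral.integral_eq_sub_of_hasDerivAt (fun t _ => hd t)]
  apply Continuous.intervalIntegrable
  fun_prop

lemma tri_fourier {T x : ℝ} (hT : 0 < T) (hx : x ≠ 0) :
    ∫ t in (-T)..T, (tri T t : ℂ) * Complex.exp (Complex.I * x * t) = (kk T x : ℂ) := by
  have hc : Continuous fun t : ℝ => (tri T t : ℂ) * Complex.exp (Complex.I * x * t) := by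
    have := tri_cont T
    fun_prop
  rw [← intervalIntegral.integral_add_adjacent_intervals (b := 0)
    (hc.intervalIntegrable _ _) (hc.intervalIntegrable _ _)]
  have e1 : ∫ t in (-T)..0, (tri T t : ℂ) * Complex.exp (Complex.I * x * t) =
      ∫ t in (-T)..0, ((1 - t / (-T) : ℝ) : ℂ) * Complex.exp (Complex.I * x * t) := by
    refine intervalIntegral.integral_congr fun t ht => ?_
    rw [Set.uIcc_of_le (by linarith)] at ht
    simp only [tri]
    rw [abs_of_nonpos ht.2, div_neg, neg_div]
  have e2 : ∫ t in (0)..T, (tri T t : ℂ) * Complex.exp (Complex.I * x * t) =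
      ∫ t in (0)..T, ((1 - t / T : ℝ) : ℂ) * Complex.exp (Complex.I * x * t) := by
    refine intervalIntegral.integral_congr fun t ht => ?_
    rw [Set.uIcc_of_le (by linarith)] at ht
    simp only [tri]
    rw [abs_of_nonneg ht.1]
  rw [e1, e2, half_int (by linarith) hx, half_int (by linarith) hx]
  unfold kk
  have hT' : (T : ℂ) ≠ 0 := by exact_mod_cast hT.ne'
  have hx' : (x : ℂ) ≠ 0 := by exact_mod_cast hx
  push_cast
  rw [Complex.cos]
  have a1 : Complex.I * x * -(T:ℂ) = -(T * x) * Complex.I := by ring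
  have a2 : Complex.I * x * (T:ℂ) = (T * x) * Complex.I := by ring
  rw [a1, a2]
  simp only [mul_pow, Complex.I_sq, mul_zero, Complex.exp_zero, neg_div_neg_eq, div_self hT']
  field_simp
  ring

lemma BB_sub_one_bdd (u : ℝ) : ‖((BB u - 1 : ℝ) : ℂ)‖ ≤ Real.log 4 + 4 := by
  rw [Complex.norm_real, Real.norm_eq_abs, abs_le]
  have h1 := BB_nonneg u
  have h2 := BB_le u
  have h3 : 0 < Real.log 4 := Real.log_pos (by norm_num)
  constructor <;> linarith

lemma fubini_step {T ε : ℝ} (hT : 0 < T) (hε : 0 < ε) (y : ℝ) :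
    ∫ t in (-T)..T, (tri T t : ℂ) * Complex.exp (Complex.I * y * t) * GG (1 + ε + Complex.I * t)
    = ∫ u in Set.Ioi (0:ℝ), ((BB u - 1 : ℝ) : ℂ) * Complex.exp (-ε * u) * kk T (y - u) := by
  have hTT : -T ≤ T := by linarith
  have e1 : ∫ t in (-T)..T, (tri T t : ℂ) * Complex.exp (Complex.I * y * t)
        * GG (1 + ε + Complex.I * t) =
      ∫ t in (-T)..T, ∫ u in Set.Ioi (0:ℝ), (tri T t : ℂ) * Complex.exp (Complex.I * (y - u) * t) *
        (((BB u - 1 : ℝ) : ℂ) * Complex.exp (-ε * u)) := by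
    refine intervalIntegral.integral_congr fun t _ => ?_
    rw [GG_eq (by simpa using hε), ← MeasureTheory.integral_const_mul]
    congr 1
    ext u
    have : Complex.exp (Complex.I * y * t) * Complex.exp (-(1 + ε + Complex.I * t - 1) * u) =
        Complex.exp (Complex.I * (y - u) * t) * Complex.exp (-ε * u) := by
      rw [← Complex.exp_add, ← Complex.exp_add]
      congr 1
      ring
    linear_combination (tri T t : ℂ) * ((BB u - 1 : ℝ) : ℂ) * this
  rw [e1, intervalIntegral.integral_of_le hTT, MeasureTheory.integral_integral_swap]
  · refine MeasureTheory.integral_congr_ae ?_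
    have : ∀ᵐ u : ℝ ∂(MeasureTheory.volume.restrict (Set.Ioi (0:ℝ))), u ≠ y :=
      MeasureTheory.ae_restrict_of_ae (MeasureTheory.Measure.ae_ne _ y)
    filter_upwards [this] with u hu
    rw [MeasureTheory.integral_mul_const, ← intervalIntegral.integral_of_le hTT]
    have := tri_fourier hT (x := y - u) (sub_ne_zero.2 hu.symm)
    push_cast at this
    rw [this]
    ring
  · have hre : (-(ε:ℂ)).re < 0 := by simpa using hε
    have hi := integrableOn_exp_mul_complex_Ioi hre 0
    have hg : MeasureTheory.IntegrableOn (fun u : ℝ => ((BB u - 1 : ℝ) : ℂ) * Complex.exp (-ε * u))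
        (Set.Ioi 0) :=
      MeasureTheory.Integrable.bdd_mul (c := Real.log 4 + 4) hi
        (Complex.measurable_ofReal.comp (BB_meas.sub_const 1)).aestronglyMeasurable
        (Eventually.of_forall BB_sub_one_bdd)
    have hf : MeasureTheory.IntegrableOn (fun t : ℝ => (tri T t : ℂ)) (Set.Ioc (-T) T) := by
      rw [← intervalIntegrable_iff_integrableOn_Ioc_of_le hTT]
      apply Continuous.intervalIntegrable
      have := tri_cont T
      fun_prop
    have hp := MeasureTheory.Integrable.mul_prod hf hg
    have := MeasureTheory.Integrable.bdd_mul (c := 1)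
      (f := fun z : ℝ × ℝ => Complex.exp (Complex.I * (y - z.2) * z.1)) hp
      (by apply Continuous.aestronglyMeasurable; fun_prop)
      (Eventually.of_forall fun z => by
        rw [Complex.norm_exp]; simp)
    refine this.congr (Eventually.of_forall fun z => ?_)
    simp only [Function.uncurry]
    ring

lemma limit_step {T : ℝ} (hT : 0 < T) (y : ℝ) :
    ∫ t in (-T)..T, (tri T t : ℂ) * Complex.exp (Complex.I * y * t) * GG (1 + Complex.I * t)
    = ∫ u in Set.Ioi (0:ℝ), ((BB u - 1 : ℝ) : ℂ) * kk T (y - u) := by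
  have hG : Continuous fun z : ℝ × ℝ => GG (1 + (max z.1 0 : ℝ) + Complex.I * z.2) := by
    refine GG_cont.comp_continuous (by fun_prop) fun z => ?_
    simp
  have hL : Tendsto (fun ε : ℝ => ∫ t in (-T)..T, (tri T t : ℂ) * Complex.exp (Complex.I * y * t)
      * GG (1 + (max ε 0 : ℝ) + Complex.I * t)) (nhdsWithin 0 (Set.Ioi 0))
      (nhds (∫ t in (-T)..T, (tri T t : ℂ) * Complex.exp (Complex.I * y * t)
        * GG (1 + (max (0:ℝ) 0 : ℝ) + Complex.I * t))) := by
    have := intervalIntegral.continuous_parametric_intervalIntegral_of_continuous'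
      (μ := MeasureTheory.volume)
      (f := fun (ε t : ℝ) => (tri T t : ℂ) * Complex.exp (Complex.I * y * t)
      * GG (1 + (max ε 0 : ℝ) + Complex.I * t)) (by
        have := tri_cont T
        refine Continuous.mul ?_ hG
        fun_prop) (-T) T
    exact (this.tendsto 0).mono_left nhdsWithin_le_nhds
  have hR : Tendsto (fun ε : ℝ => ∫ u in Set.Ioi (0:ℝ), ((BB u - 1 : ℝ) : ℂ) *
      Complex.exp (-ε * u) * kk T (y - u)) (nhdsWithin 0 (Set.Ioi 0))
      (nhds (∫ u in Set.Ioi (0:ℝ), ((BB u - 1 : ℝ) : ℂ) * kk T (y - u))) := by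
    have hk : MeasureTheory.Integrable (fun u => kk T (y - u)) := (kk_int hT).comp_sub_left y
    refine MeasureTheory.tendsto_integral_filter_of_dominated_convergence
      (fun u => (Real.log 4 + 4) * kk T (y - u)) ?_ ?_ (hk.const_mul _).integrableOn ?_
    · refine Eventually.of_forall fun ε => Measurable.aestronglyMeasurable ?_
      have := BB_meas
      have := kk_meas T
      fun_prop
    · filter_upwards [self_mem_nhdsWithin] with ε hε
      filter_upwards [MeasureTheory.ae_restrict_mem measurableSet_Ioi] with u hu
      rw [norm_mul, norm_mul, Complex.norm_real (kk _ _), Real.norm_of_nonneg (kk_nonneg hT _)]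
      refine mul_le_mul_of_nonneg_right ?_ (kk_nonneg hT _)
      have h1 := BB_sub_one_bdd u
      have h2 : ‖Complex.exp (-ε * u)‖ ≤ 1 := by
        rw [Complex.norm_exp]
        simp only [Set.mem_Ioi] at hε hu
        simp
        positivity
      calc _ ≤ (Real.log 4 + 4) * 1 := mul_le_mul h1 h2 (norm_nonneg _) (le_trans (norm_nonneg _) h1)
        _ = _ := mul_one _
    · refine Eventually.of_forall fun u => ?_
      have hc : Continuous fun ε : ℝ => ((BB u - 1 : ℝ) : ℂ) * Complex.exp (-ε * u) * kk T (y - u) := by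
        fun_prop
      have := (hc.tendsto 0).mono_left (nhdsWithin_le_nhds (s := Set.Ioi 0))
      simpa using this
  have hE : (fun ε : ℝ => ∫ t in (-T)..T, (tri T t : ℂ) * Complex.exp (Complex.I * y * t)
      * GG (1 + (max ε 0 : ℝ) + Complex.I * t)) =ᶠ[nhdsWithin 0 (Set.Ioi 0)]
      (fun ε : ℝ => ∫ u in Set.Ioi (0:ℝ), ((BB u - 1 : ℝ) : ℂ) *
      Complex.exp (-ε * u) * kk T (y - u)) := by
    filter_upwards [self_mem_nhdsWithin] with ε hε
    rw [max_eq_left (le_of_lt hε)]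
    exact fubini_step hT hε y
  have := tendsto_nhds_unique (hL.congr' hE) hR
  simpa using this

lemma RL_step {T : ℝ} (hT : 0 < T) :
    Tendsto (fun y : ℝ => ∫ u in Set.Ioi (0:ℝ), ((BB u - 1 : ℝ) : ℂ) * kk T (y - u)) atTop (nhds 0) := by
  have h := Real.tendsto_integral_exp_smul_cocompact
    ((Set.Ioc (-T) T).indicator fun t : ℝ => (tri T t : ℂ) * GG (1 + Complex.I * t))
  have h2 : Tendsto (fun y : ℝ => -(2 * π)⁻¹ * y) atTop (cocompact ℝ) := by
    refine Tendsto.mono_right ?_ atBot_le_cocompact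
    exact tendsto_id.const_mul_atTop_of_neg (by simp [Real.pi_pos])
  refine (h.comp h2).congr fun y => ?_
  rw [← limit_step hT y, intervalIntegral.integral_of_le (by linarith),
    ← MeasureTheory.integral_indicator measurableSet_Ioc]
  simp only [Function.comp]
  congr 1
  ext t
  by_cases ht : t ∈ Set.Ioc (-T) T
  · rw [Set.indicator_of_mem ht, Set.indicator_of_mem ht, Circle.smul_def, Real.fourierChar_apply,
      smul_eq_mul]
    have : ((2 * π * -(t * (-(2 * π)⁻¹ * y)) : ℝ) : ℂ) * Complex.I = Complex.I * y * t := by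
      have : 2 * π * -(t * (-(2 * π)⁻¹ * y)) = y * t := by
        have := Real.pi_ne_zero
        field_simp
      rw [this]; push_cast; ring
    rw [this]; ring
  · rw [Set.indicator_of_notMem ht, Set.indicator_of_notMem ht, smul_zero]

lemma conv_int {T : ℝ} (hT : 0 < T) (y : ℝ) :
    MeasureTheory.Integrable (fun u => BB u * kk T (y - u)) := by
  refine MeasureTheory.Integrable.bdd_mul (c := Real.log 4 + 4) ((kk_int hT).comp_sub_left y)
    BB_meas.aestronglyMeasurable (Eventually.of_forall fun u => ?_)
  rw [Real.norm_of_nonneg (BB_nonneg u)]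
  exact BB_le u

lemma conv_lim {T : ℝ} (hT : 0 < T) :
    Tendsto (fun y : ℝ => ∫ z, BB (y - T⁻¹ * z) * kk 1 z) atTop (nhds (∫ z, kk 1 z)) := by
  have h1 : Tendsto (fun y : ℝ => ∫ u in Set.Ioi (0:ℝ), (BB u - 1) * kk T (y - u))
      atTop (nhds 0) := by
    have h := (Complex.continuous_re.tendsto 0).comp (RL_step hT)
    refine h.congr fun y => ?_
    simp only [Function.comp]
    rw [← Complex.ofReal_re (∫ u in Set.Ioi (0:ℝ), (BB u - 1) * kk T (y - u)), ← integral_complex_ofReal]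
    push_cast
    rfl
  have h2 : Tendsto (fun y : ℝ => ∫ u in Set.Ioi (0:ℝ), kk T (y - u))
      atTop (nhds (∫ x, kk T x)) := by
    have e : ∀ y : ℝ, ∫ u in Set.Ioi (0:ℝ), kk T (y - u) =
        ∫ x, (Set.Iio y).indicator (kk T) x := by
      intro y
      rw [← MeasureTheory.integral_indicator measurableSet_Ioi,
        ← MeasureTheory.integral_sub_left_eq_self _ _ y]
      congr 1
      ext x
      by_cases hx : x < y
      · rw [Set.indicator_of_mem (by simpa using hx), Set.indicator_of_mem (by simpa using hx)]
        simp
      · rw [Set.indicator_of_notMem (by simpa using hx), Set.indicator_of_notMem (by simpa using hx)]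
    simp only [e]
    refine MeasureTheory.tendsto_integral_filter_of_dominated_convergence (kk T) ?_ ?_ (kk_int hT) ?_
    · exact Eventually.of_forall fun y =>
        ((kk_meas T).indicator measurableSet_Iio).aestronglyMeasurable
    · refine Eventually.of_forall fun y => Eventually.of_forall fun x => ?_
      refine (norm_indicator_le_norm_self _ _).trans ?_
      rw [Real.norm_of_nonneg (kk_nonneg hT x)]
    · refine Eventually.of_forall fun x => ?_
      refine tendsto_const_nhds.congr' ?_
      filter_upwards [eventually_gt_atTop x] with y hy
      rw [Set.indicator_of_mem (by simpa using hy)]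
  have h3 := h1.add h2
  have h4 : ∫ x, kk T x = ∫ x, kk 1 x := by
    simpa using kk_integral_scale hT (fun _ => 1)
  rw [zero_add, h4] at h3
  refine h3.congr fun y => ?_
  have hi := conv_int hT y
  have hk : MeasureTheory.Integrable (fun u => kk T (y - u)) := (kk_int hT).comp_sub_left y
  rw [← MeasureTheory.integral_add]
  · have : ∀ u, (BB u - 1) * kk T (y - u) + kk T (y - u) = BB u * kk T (y - u) := fun u => by ring
    simp only [this]
    rw [MeasureTheory.setIntegral_eq_integral_of_forall_compl_eq_zero]
    · rw [← MeasureTheory.integral_sub_left_eq_self _ _ y]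
      simp only [sub_sub_cancel]
      exact kk_integral_scale hT (fun x => BB (y - x))
    · intro u hu
      rw [BB_zero (by simpa using hu), zero_mul]
  · have := (hi.sub hk).integrableOn (s := Set.Ioi 0)
    refine this.congr (Eventually.of_forall fun u => ?_)
    simp only [Pi.sub_apply]
    ring
  · exact hk.integrableOn

lemma conv_int1 (T : ℝ) (y : ℝ) :
    MeasureTheory.Integrable (fun z => BB (y - T⁻¹ * z) * kk 1 z) := by
  refine MeasureTheory.Integrable.bdd_mul (c := Real.log 4 + 4) (kk_int one_pos)
    (BB_meas.comp (by fun_prop)).aestronglyMeasurable (Eventually.of_forall fun u => ?_)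
  rw [Real.norm_of_nonneg (BB_nonneg _)]
  exact BB_le _

lemma tail_small {η : ℝ} (hη : 0 < η) :
    ∃ R : ℝ, 0 < R ∧ ∫ z in (Set.Icc (-R) R)ᶜ, kk 1 z ≤ η := by
  have h : Tendsto (fun R : ℝ => ∫ z, (Set.Icc (-R) R)ᶜ.indicator (kk 1) z) atTop (nhds (∫ _ : ℝ, (0:ℝ))) := by
    refine MeasureTheory.tendsto_integral_filter_of_dominated_convergence (kk 1) ?_ ?_
      (kk_int one_pos) ?_
    · exact Eventually.of_forall fun y =>
        ((kk_meas 1).indicator measurableSet_Icc.compl).aestronglyMeasurable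
    · refine Eventually.of_forall fun y => Eventually.of_forall fun x => ?_
      refine (norm_indicator_le_norm_self _ _).trans ?_
      rw [Real.norm_of_nonneg (kk_nonneg one_pos x)]
    · refine Eventually.of_forall fun x => ?_
      refine tendsto_const_nhds.congr' ?_
      filter_upwards [eventually_ge_atTop |x|] with y hy
      rw [Set.indicator_of_notMem]
      simpa using abs_le.1 hy
  rw [MeasureTheory.integral_zero] at h
  obtain ⟨R, h1, h2⟩ := ((h.eventually (gt_mem_nhds hη)).and (eventually_gt_atTop 0)).exists
  refine ⟨R, h2, ?_⟩
  rw [← MeasureTheory.integral_indicator measurableSet_Icc.compl]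
  exact h1.le

lemma BB_bounds {δ η : ℝ} (hδ : 0 < δ) (hη : 0 < η) :
    ∀ᶠ y in atTop, BB y * Real.exp (-(2*δ)) * ((∫ z, kk 1 z) - η) ≤ (∫ z, kk 1 z) + η ∧
      (∫ z, kk 1 z) - η ≤ BB y * Real.exp (2*δ) * (∫ z, kk 1 z) + (Real.log 4 + 4) * η := by
  obtain ⟨R, hR, hRη⟩ := tail_small hη
  set c := ∫ z, kk 1 z with hc
  have hk := kk_int one_pos
  have hsplit := MeasureTheory.integral_add_compl (s := Set.Icc (-R) R) measurableSet_Icc hk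
  rw [← hc] at hsplit
  set T := R / δ with hTdef
  have hT : 0 < T := by positivity
  have hzT : ∀ z ∈ Set.Icc (-R) R, -δ ≤ T⁻¹ * z ∧ T⁻¹ * z ≤ δ := by
    intro z hz
    have h1 : T⁻¹ * z = δ * (z / R) := by rw [hTdef]; field_simp
    rw [h1]
    have h2 : z / R ≤ 1 := (div_le_one hR).2 hz.2
    have h3 : -1 ≤ z / R := by rw [le_div_iff₀ hR]; linarith [hz.1]
    constructor <;> nlinarith
  have hlim := conv_lim hT
  have hup := (hlim.comp (tendsto_atTop_add_const_right atTop δ tendsto_id)).eventually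
    (gt_mem_nhds (show c < c + η by linarith))
  have hlo := (hlim.comp (tendsto_atTop_add_const_right atTop (-δ) tendsto_id)).eventually
    (lt_mem_nhds (show c - η < c by linarith))
  filter_upwards [hup, hlo] with y h1 h2
  simp only [Function.comp, id] at h1 h2
  constructor
  · refine le_trans ?_ h1.le
    have hi := conv_int1 T (y + δ)
    calc BB y * Real.exp (-(2*δ)) * (c - η)
        ≤ BB y * Real.exp (-(2*δ)) * ∫ z in Set.Icc (-R) R, kk 1 z := by
          refine mul_le_mul_of_nonneg_left (by linarith)
            (mul_nonneg (BB_nonneg _) (Real.exp_pos _).le)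
      _ = ∫ z in Set.Icc (-R) R, BB y * Real.exp (-(2*δ)) * kk 1 z := by
          rw [MeasureTheory.integral_const_mul]
      _ ≤ ∫ z in Set.Icc (-R) R, BB (y + δ - T⁻¹ * z) * kk 1 z := by
          refine MeasureTheory.setIntegral_mono_on (hk.const_mul _).integrableOn hi.integrableOn
            measurableSet_Icc fun z hz => ?_
          refine mul_le_mul_of_nonneg_right ?_ (kk_nonneg one_pos z)
          obtain ⟨a1, a2⟩ := hzT z hz
          refine le_trans ?_ (BB_mono (u := y) (v := y + δ - T⁻¹ * z) (by linarith))
          refine mul_le_mul_of_nonneg_left (Real.exp_le_exp.2 (by linarith)) (BB_nonneg _)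
      _ ≤ ∫ z, BB (y + δ - T⁻¹ * z) * kk 1 z := by
          refine MeasureTheory.setIntegral_le_integral hi (Eventually.of_forall fun z => ?_)
          exact mul_nonneg (BB_nonneg _) (kk_nonneg one_pos z)
  · refine le_trans h2.le ?_
    have hi := conv_int1 T (y + -δ)
    have h4 : 0 < Real.log 4 := Real.log_pos (by norm_num)
    have hcompl : 0 ≤ ∫ z in (Set.Icc (-R) R)ᶜ, kk 1 z :=
      MeasureTheory.integral_nonneg (kk_nonneg one_pos)
    rw [← MeasureTheory.integral_add_compl (s := Set.Icc (-R) R) measurableSet_Icc hi]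
    refine add_le_add ?_ ?_
    · calc _ ≤ ∫ z in Set.Icc (-R) R, BB y * Real.exp (2*δ) * kk 1 z := by
            refine MeasureTheory.setIntegral_mono_on hi.integrableOn (hk.const_mul _).integrableOn
              measurableSet_Icc fun z hz => ?_
            refine mul_le_mul_of_nonneg_right ?_ (kk_nonneg one_pos z)
            obtain ⟨a1, a2⟩ := hzT z hz
            have h5 := BB_mono (u := y + -δ - T⁻¹ * z) (v := y) (by linarith)
            calc BB (y + -δ - T⁻¹ * z)
                = BB (y + -δ - T⁻¹ * z) * Real.exp (y + -δ - T⁻¹ * z - y)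
                  * Real.exp (-(y + -δ - T⁻¹ * z - y)) := by
                  rw [mul_assoc, ← Real.exp_add]; simp
              _ ≤ BB y * Real.exp (-(y + -δ - T⁻¹ * z - y)) :=
                  mul_le_mul_of_nonneg_right h5 (Real.exp_pos _).le
              _ ≤ BB y * Real.exp (2 * δ) :=
                  mul_le_mul_of_nonneg_left (Real.exp_le_exp.2 (by linarith)) (BB_nonneg _)
        _ = BB y * Real.exp (2*δ) * ∫ z in Set.Icc (-R) R, kk 1 z := by
            rw [MeasureTheory.integral_const_mul]
        _ ≤ _ := mul_le_mul_of_nonneg_left (by linarith)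
            (mul_nonneg (BB_nonneg _) (Real.exp_pos _).le)
    · calc _ ≤ ∫ z in (Set.Icc (-R) R)ᶜ, (Real.log 4 + 4) * kk 1 z := by
            refine MeasureTheory.setIntegral_mono_on hi.integrableOn (hk.const_mul _).integrableOn
              measurableSet_Icc.compl fun z hz => ?_
            exact mul_le_mul_of_nonneg_right (BB_le _) (kk_nonneg one_pos z)
        _ = (Real.log 4 + 4) * ∫ z in (Set.Icc (-R) R)ᶜ, kk 1 z := by
            rw [MeasureTheory.integral_const_mul]
        _ ≤ _ := mul_le_mul_of_nonneg_left hRη (by linarith)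

lemma BB_tendsto : Tendsto BB atTop (nhds 1) := by
  have hc := kk_pos
  set c := ∫ z, kk 1 z with hcdef
  have hU : Tendsto (fun δ : ℝ => (c + δ) / (Real.exp (-(2*δ)) * (c - δ)))
      (nhdsWithin 0 (Set.Ioi 0)) (nhds 1) := by
    have : ContinuousAt (fun δ : ℝ => (c + δ) / (Real.exp (-(2*δ)) * (c - δ))) 0 := by
      refine ContinuousAt.div (by fun_prop) (by fun_prop) ?_
      simpa using hc.ne'
    have h := this.tendsto.mono_left (nhdsWithin_le_nhds (s := Set.Ioi 0))
    simpa [div_self hc.ne'] using h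
  have hL : Tendsto (fun δ : ℝ => (c - δ - (Real.log 4 + 4) * δ) / (Real.exp (2*δ) * c))
      (nhdsWithin 0 (Set.Ioi 0)) (nhds 1) := by
    have : ContinuousAt (fun δ : ℝ => (c - δ - (Real.log 4 + 4) * δ) / (Real.exp (2*δ) * c)) 0 := by
      refine ContinuousAt.div (by fun_prop) (by fun_prop) ?_
      simpa using hc.ne'
    have h := this.tendsto.mono_left (nhdsWithin_le_nhds (s := Set.Ioi 0))
    simpa [div_self hc.ne'] using h
  have hsm : ∀ᶠ δ : ℝ in nhdsWithin 0 (Set.Ioi 0), δ < c :=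
    nhdsWithin_le_nhds (gt_mem_nhds hc)
  rw [tendsto_order]
  constructor
  · intro a ha
    obtain ⟨δ, h1, h2⟩ := ((hL.eventually (lt_mem_nhds ha)).and self_mem_nhdsWithin).exists
    filter_upwards [BB_bounds h2 h2] with y hy
    refine lt_of_lt_of_le h1 ?_
    rw [div_le_iff₀ (by positivity)]
    nlinarith [hy.2]
  · intro a ha
    obtain ⟨δ, ⟨h1, h2⟩, h3⟩ :=
      (((hU.eventually (gt_mem_nhds ha)).and self_mem_nhdsWithin).and hsm).exists
    filter_upwards [BB_bounds h2 h2] with y hy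
    refine lt_of_le_of_lt ?_ h1
    rw [le_div_iff₀ (mul_pos (Real.exp_pos _) (by linarith))]
    nlinarith [hy.1]

lemma psi_tendsto : Tendsto (fun x => Chebyshev.psi x / x) atTop (nhds 1) := by
  refine (BB_tendsto.comp Real.tendsto_log_atTop).congr' ?_
  filter_upwards [eventually_gt_atTop 0] with x hx
  simp only [Function.comp, BB]
  rw [Real.exp_neg, Real.exp_log hx, div_eq_mul_inv]

open Asymptotics in
lemma pnt : Tendsto (fun x : ℝ => (Nat.primeCounting ⌊x⌋₊ : ℝ) * Real.log x / x) atTop (nhds 1) := by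
  have h1 : Tendsto (fun x => (Chebyshev.psi x - Chebyshev.theta x) / x) atTop (nhds 0) := by
    have h := Chebyshev.isBigO_psi_sub_theta_sqrt.trans_isLittleO (k := fun x : ℝ => x) (by
      refine isLittleO_of_tendsto' ?_ ?_
      · filter_upwards [eventually_gt_atTop 0] with x hx h0
        exact absurd h0 hx.ne'
      · have : Tendsto (fun x : ℝ => (√x)⁻¹) atTop (nhds 0) :=
          tendsto_inv_atTop_zero.comp Real.tendsto_sqrt_atTop
        refine this.congr fun x => ?_
        rw [Real.sqrt_div_self']; simp)
    exact h.tendsto_div_nhds_zero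
  have h2 : Tendsto (fun x : ℝ => ((Nat.primeCounting ⌊x⌋₊ : ℝ) - Chebyshev.theta x / Real.log x) /
      (x / Real.log x)) atTop (nhds 0) := by
    refine (Chebyshev.primeCounting_sub_theta_div_log_isBigO.trans_isLittleO
      (k := fun x : ℝ => x / Real.log x) ?_).tendsto_div_nhds_zero
    refine isLittleO_of_tendsto' ?_ ?_
    · filter_upwards [eventually_gt_atTop 1] with x hx h0
      have := Real.log_pos hx
      exact absurd h0 (by positivity)
    · refine (tendsto_inv_atTop_zero.comp Real.tendsto_log_atTop).congr' ?_
      filter_upwards [eventually_gt_atTop 1] with x hx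
      have := Real.log_pos hx
      simp only [Function.comp]
      field_simp
  have h3 := (psi_tendsto.sub h1).add h2
  rw [sub_zero, add_zero] at h3
  refine h3.congr' ?_
  filter_upwards [eventually_gt_atTop 1] with x hx
  have := Real.log_pos hx
  field_simp
  ring

lemma p_le_iff {r m : ℕ} (hr : 1 ≤ r) : p r ≤ m ↔ r ≤ Nat.primeCounting m := by
  unfold p Nat.primeCounting Nat.primeCounting'
  have h : r - 1 < Nat.count Nat.Prime (m + 1) ↔ Nat.nth Nat.Prime (r - 1) < m + 1 :=
    Nat.lt_nth_iff_count_lt Nat.infinite_setOfPred_prime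
  omega

lemma pi_p {n : ℕ} (hn : 1 ≤ n) : Nat.primeCounting (p n) = n := by
  unfold p Nat.primeCounting Nat.primeCounting'
  rw [Nat.count_nth_succ_of_infinite Nat.infinite_setOfPred_prime]
  omega

lemma p_atTop : Tendsto (fun n => (p n : ℝ)) atTop atTop := by
  refine tendsto_natCast_atTop_atTop.comp ?_
  refine tendsto_atTop_mono' atTop (f₁ := fun n => n) ?_ tendsto_id
  filter_upwards [eventually_ge_atTop 1] with n hn
  have := Nat.add_two_le_nth_prime (n - 1)
  unfold p
  omega

lemma card_le {n : ℕ} (hn : 1 ≤ n) {x : ℝ} (hx : 0 ≤ x) (hxn : x ≤ p n) :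
    ((Finset.Icc 1 n).filter (fun r => (p r : ℝ) ≤ x)).card = Nat.primeCounting ⌊x⌋₊ := by
  have : (Finset.Icc 1 n).filter (fun r => (p r : ℝ) ≤ x) =
      Finset.Icc 1 (Nat.primeCounting ⌊x⌋₊) := by
    ext r
    have hle : Nat.primeCounting ⌊x⌋₊ ≤ n := by
      conv_rhs => rw [← pi_p hn]
      exact Nat.monotone_primeCounting (Nat.floor_le_of_le hxn)
    simp only [Finset.mem_filter, Finset.mem_Icc, ← Nat.le_floor_iff hx]
    constructor
    · rintro ⟨⟨h1, h2⟩, h3⟩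
      exact ⟨h1, (p_le_iff h1).1 h3⟩
    · rintro ⟨h1, h2⟩
      exact ⟨⟨h1, h2.trans hle⟩, (p_le_iff h1).2 h2⟩
  rw [this]; simp

lemma ratio_lim {l : ℝ} (hl : 0 ≤ l) :
    Tendsto (fun x : ℝ => (Nat.primeCounting ⌊l * x⌋₊ : ℝ) / Nat.primeCounting ⌊x⌋₊)
      atTop (nhds l) := by
  rcases hl.eq_or_lt with rfl | hl
  · simp
  have h1 : Tendsto (fun x : ℝ => l * x) atTop atTop := tendsto_id.const_mul_atTop hl
  have h2 := pnt.comp h1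
  have h3 : Tendsto (fun x : ℝ => Real.log (l * x) / Real.log x) atTop (nhds 1) := by
    have : Tendsto (fun x : ℝ => Real.log l / Real.log x + 1) atTop (nhds (0 + 1)) :=
      (Real.tendsto_log_atTop.const_div_atTop _).add_const 1
    rw [zero_add] at this
    refine this.congr' ?_
    filter_upwards [eventually_gt_atTop 1] with x hx
    have := Real.log_pos hx
    rw [Real.log_mul hl.ne' (by linarith)]
    field_simp
  have h4 := ((h2.div pnt one_ne_zero).div h3 one_ne_zero).const_mul l
  simp only [div_one, mul_one] at h4
  refine h4.congr' ?_
  filter_upwards [eventually_gt_atTop 1, h1.eventually (eventually_gt_atTop 1),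
    eventually_ge_atTop 2] with x hx hlx hx2
  have a1 := Real.log_pos hx
  have a2 := Real.log_pos hlx
  have a3 : (0:ℝ) < Nat.primeCounting ⌊x⌋₊ := by
    have : 1 ≤ Nat.primeCounting ⌊x⌋₊ := by
      have := Nat.monotone_primeCounting (Nat.le_floor (n := 2) (by exact_mod_cast hx2))
      exact le_trans (by decide) this
    exact_mod_cast this
  simp only [Function.comp, Pi.div_apply]
  field_simp

lemma ratio_n {l : ℝ} (hl : 0 ≤ l) :
    Tendsto (fun n : ℕ => (Nat.primeCounting ⌊l * p n⌋₊ : ℝ) / n) atTop (nhds l) := by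
  refine ((ratio_lim hl).comp p_atTop).congr' ?_
  filter_upwards [eventually_ge_atTop 1] with n hn
  simp only [Function.comp, Nat.floor_natCast, pi_p hn]

theorem stmt_5 (a b : ℝ) (ha : 0 ≤ a) (hab : a < b) (hb : b ≤ 1) :
    Tendsto
      (fun n : ℕ =>
        (((Finset.Icc 1 n).filter
            (fun r => a ≤ (p r : ℝ) / (p n : ℝ) ∧ (p r : ℝ) / (p n : ℝ) ≤ b)).card : ℝ) / n)
      atTop (nhds (b - a)) := by
  have hA := ratio_n ha
  have hB := ratio_n (ha.trans hab.le)
  have hlow := hB.sub hA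
  have hup := hlow.add (tendsto_inv_atTop_zero.comp (tendsto_natCast_atTop_atTop (R := ℝ)))
  rw [add_zero] at hup
  have key : ∀ᶠ n : ℕ in atTop, 1 ≤ n ∧
      Nat.primeCounting ⌊b * p n⌋₊ ≤ ((Finset.Icc 1 n).filter
            (fun r => a ≤ (p r : ℝ) / (p n : ℝ) ∧ (p r : ℝ) / (p n : ℝ) ≤ b)).card
            + Nat.primeCounting ⌊a * p n⌋₊ ∧
      ((Finset.Icc 1 n).filter
            (fun r => a ≤ (p r : ℝ) / (p n : ℝ) ∧ (p r : ℝ) / (p n : ℝ) ≤ b)).card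
            + Nat.primeCounting ⌊a * p n⌋₊ ≤ Nat.primeCounting ⌊b * p n⌋₊ + 1 := by
    filter_upwards [eventually_ge_atTop 1, p_atTop.eventually (eventually_gt_atTop 0)] with n hn hP
    refine ⟨hn, ?_⟩
    rw [← card_le hn (mul_nonneg (ha.trans hab.le) hP.le) (by nlinarith),
      ← card_le hn (mul_nonneg ha hP.le) (by nlinarith)]
    simp only [div_le_iff₀ hP, le_div_iff₀ hP]
    have hab' : a * p n < b * p n := by nlinarith
    constructor
    · refine le_trans (Finset.card_le_card ?_) (Finset.card_union_le _ _)
      intro r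
      simp only [Finset.mem_union, Finset.mem_filter]
      rintro ⟨h1, h2⟩
      rcases le_total (a * p n) (p r) with h | h
      · exact Or.inl ⟨h1, h, h2⟩
      · exact Or.inr ⟨h1, h⟩
    · rw [← Finset.card_union_add_card_inter]
      refine add_le_add (Finset.card_le_card ?_) (Finset.card_le_one.2 ?_)
      · intro r
        simp only [Finset.mem_union, Finset.mem_filter]
        rintro (⟨h1, h2, h3⟩ | ⟨h1, h2⟩)
        · exact ⟨h1, h3⟩
        · exact ⟨h1, h2.trans hab'.le⟩
      · intro r hr s hs
        simp only [Finset.mem_inter, Finset.mem_filter, Finset.mem_Icc] at hr hs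
        have e : (p r : ℝ) = p s := by
          rw [le_antisymm hr.2.2 hr.1.2.1, le_antisymm hs.2.2 hs.1.2.1]
        have e' : p r = p s := by exact_mod_cast e
        rw [← pi_p hr.1.1.1, e', pi_p hs.1.1.1]
  refine tendsto_of_tendsto_of_tendsto_of_le_of_le' hlow hup ?_ ?_
  · filter_upwards [key] with n ⟨hn, h1, h2⟩
    have hn' : (0:ℝ) < n := by exact_mod_cast hn
    rw [← sub_div]
    refine div_le_div_of_nonneg_right ?_ hn'.le
    rw [sub_le_iff_le_add]
    exact_mod_cast h1
  · filter_upwards [key] with n ⟨hn, h1, h2⟩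
    have hn' : (0:ℝ) < n := by exact_mod_cast hn
    simp only [Function.comp]
    rw [← sub_div, inv_eq_one_div, ← add_div]
    refine div_le_div_of_nonneg_right ?_ hn'.le
    rw [sub_add_eq_add_sub, le_sub_iff_add_le]
    exact_mod_cast h2
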